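/- The position- and symbol-axis attention lifts of SE-RRM are each equivariant under both axis permutations: for every σ : Equiv.Perm (Fin I), every ρ : Equiv.Perm (Fin K), and every tensor Z : Fin D → Fin I → Fin K → ℝ, TI (PosT σ Z) = PosT σ (TI Z), TI (SymT ρ Z) = SymT ρ (TI Z), TK (PosT σ Z) = PosT σ (TK Z), and TK (SymT ρ Z) = SymT ρ (TK Z). -/

import Mathlib

open Matrix BigOperators

noncomputable def softmax {n : ℕ} (x : Fin n → ℝ) : Fin n → ℝ :=
  fun i => Real.exp (x i) / ∑ j, Real.exp (x j)

noncomputable def Attn {D n : ℕ} (Wq Wk Wv : Matrix (Fin D) (Fin D) ℝ)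
    (H : Matrix (Fin D) (Fin n) ℝ) : Matrix (Fin D) (Fin n) ℝ :=
  fun d j =>
    ∑ i, (softmax (fun i' =>
        dotProduct (Wq.mulVec (fun d => H d j)) (Wk.mulVec (fun d => H d i')))) i *
      (Wv.mulVec (fun d' => H d' i)) d

def PosT {D I K : ℕ} (σ : Equiv.Perm (Fin I)) (Z : Fin D → Fin I → Fin K → ℝ) :
    Fin D → Fin I → Fin K → ℝ :=
  fun d i k => Z d (σ i) k

def SymT {D I K : ℕ} (ρ : Equiv.Perm (Fin K)) (Z : Fin D → Fin I → Fin K → ℝ) :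
    Fin D → Fin I → Fin K → ℝ :=
  fun d i k => Z d i (ρ k)

noncomputable def TI {D I K : ℕ} (Wq Wk Wv : Matrix (Fin D) (Fin D) ℝ)
    (Z : Fin D → Fin I → Fin K → ℝ) : Fin D → Fin I → Fin K → ℝ :=
  fun d i k => (Attn Wq Wk Wv (fun d' i' => Z d' i' k)) d i

noncomputable def TK {D I K : ℕ} (Wq Wk Wv : Matrix (Fin D) (Fin D) ℝ)
    (Z : Fin D → Fin I → Fin K → ℝ) : Fin D → Fin I → Fin K → ℝ :=
  fun d i k => (Attn Wq Wk Wv (fun d' k' => Z d' i k')) d k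

def FiberT {D I K : ℕ} (g : (Fin D → ℝ) → (Fin D → ℝ))
    (Z : Fin D → Fin I → Fin K → ℝ) : Fin D → Fin I → Fin K → ℝ :=
  fun d i k => g (fun d' => Z d' i k) d

noncomputable def SLayer {D I K : ℕ} (Wq Wk Wv Wq' Wk' Wv' : Matrix (Fin D) (Fin D) ℝ)
    (norm m : (Fin D → ℝ) → (Fin D → ℝ))
    (Z : Fin D → Fin I → Fin K → ℝ) : Fin D → Fin I → Fin K → ℝ :=
  let Z' := FiberT norm (Z + TI Wq Wk Wv Z)
  let Z'' := FiberT norm (Z' + TK Wq' Wk' Wv' Z')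
  FiberT norm (Z'' + FiberT m Z'')

noncomputable def SBlock {D I K : ℕ} (Wq Wk Wv Wq' Wk' Wv' : Matrix (Fin D) (Fin D) ℝ)
    (norm m : (Fin D → ℝ) → (Fin D → ℝ)) (L : ℕ) :
    (Fin D → Fin I → Fin K → ℝ) → (Fin D → Fin I → Fin K → ℝ) :=
  (SLayer Wq Wk Wv Wq' Wk' Wv' norm m)^[L]

noncomputable def Emb {D I K : ℕ} (d₀ : Fin D → ℝ) (X : Fin I → Fin K) :
    Fin D → Fin I → Fin K → ℝ :=
  fun a i k => if X i = k then d₀ a else 0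

theorem softmax_comp_perm {n : ℕ} (σ : Equiv.Perm (Fin n)) (x : Fin n → ℝ) :
    softmax (fun i => x (σ i)) = fun i => softmax x (σ i) := by
  funext i
  simp only [softmax, Equiv.sum_comp σ (fun j => Real.exp (x j))]

theorem Attn_comp_perm {D n : ℕ} (Wq Wk Wv : Matrix (Fin D) (Fin D) ℝ)
    (σ : Equiv.Perm (Fin n)) (H : Matrix (Fin D) (Fin n) ℝ) :
    Attn Wq Wk Wv (fun d i => H d (σ i)) = fun d j => Attn Wq Wk Wv H d (σ j) := by
  funext d j
  unfold Attn
  rw [softmax_comp_perm σ (fun i =>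
    dotProduct (Wq.mulVec (fun d => H d (σ j))) (Wk.mulVec (fun d => H d i)))]
  exact Equiv.sum_comp σ (fun i => softmax (fun i' =>
    dotProduct (Wq.mulVec (fun d => H d (σ j))) (Wk.mulVec (fun d => H d i'))) i *
      Wv.mulVec (fun d' => H d' i) d)

theorem attention_lifts_equivariant {D I K : ℕ}
    (Wq Wk Wv Wq' Wk' Wv' : Matrix (Fin D) (Fin D) ℝ)
    (σ : Equiv.Perm (Fin I)) (ρ : Equiv.Perm (Fin K))
    (Z : Fin D → Fin I → Fin K → ℝ) :
    TI Wq Wk Wv (PosT σ Z) = PosT σ (TI Wq Wk Wv Z) ∧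
    TI Wq Wk Wv (SymT ρ Z) = SymT ρ (TI Wq Wk Wv Z) ∧
    TK Wq' Wk' Wv' (PosT σ Z) = PosT σ (TK Wq' Wk' Wv' Z) ∧
    TK Wq' Wk' Wv' (SymT ρ Z) = SymT ρ (TK Wq' Wk' Wv' Z) := by
  refine ⟨?_, rfl, rfl, ?_⟩
  · funext d i k
    exact congrFun (congrFun (Attn_comp_perm Wq Wk Wv σ (fun d' i' => Z d' i' k)) d) i
  · funext d i k
    exact congrFun (congrFun (Attn_comp_perm Wq' Wk' Wv' ρ (fun d' k' => Z d' i k')) d) k
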